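/- Fix an integer d ≥ 13 and λ ∈ ℝ. Suppose Θ : ℝ → ℝ is a C² solution of the truncated equation with Θ(t) − e^t + (2d)^{-1}e^{3t} = O(e^{5t}), Θ'(t) − e^t = O(e^{3t}), and Θ''(t) − e^t = O(e^{3t}) as t → −∞. Suppose that for each b > 0, Ψ_b : ℝ → ℝ is a C² solution of equation (E_λ) with Ψ_b(t) − b e^t + (λ b + b³)(2d)^{-1}e^{3t} = O(e^{5t}) as t → −∞, that b ↦ Ψ_b(t) is differentiable for each t with derivative γ_b(t) := ∂_b Ψ_b(t) defining a C² solution of the linearized equation (M_{Ψ_b,λ}), and that γ_b(t) − e^t = O(e^{3t}) as t → −∞ for each b. Then: (i) there exist b₀ > 0 and C₀ > 0 such that for every b > b₀, sup over t ≤ 0 of |γ_b(t − log b) − b^{-1}Θ'(t)| plus sup over t ≤ 0 of |γ_b'(t − log b) − b^{-1}Θ''(t)| is at most C₀ b^{−3}; and (ii) for every T > 0 and a ∈ (0,1) there exist b_{T,a} > 0 and C_{T,a} > 0 such that for every b > b_{T,a}, sup over t ∈ [0, T + a·log b] of |γ_b(t − log b) − b^{-1}Θ'(t)| plus sup over t ∈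 [0, T + a·log b] of |γ_b'(t − log b) − b^{-1}Θ''(t)| is at most C_{T,a} b^{−2(1−a)−1}. -/

import Mathlib

open Filter Asymptotics Topology Set

lemma aux_anti {f f' : ℝ → ℝ} {τ : ℝ} (hf : ∀ t, HasDerivAt f (f' t) t)
    (hn : ∀ t ≤ τ, f' t ≤ 0) {s t : ℝ} (hst : s ≤ t) (ht : t ≤ τ) : f t ≤ f s := by
  have : AntitoneOn f (Set.Iic τ) := by
    apply antitoneOn_of_deriv_nonpos (convex_Iic τ)
    · exact fun x _ => (hf x).continuousAt.continuousWithinAt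
    · exact fun x _ => (hf x).differentiableAt.differentiableWithinAt
    · intro x hx
      rw [interior_Iic] at hx
      rw [(hf x).deriv]
      exact hn x (le_of_lt hx)
  exact this (hst.trans ht) ht hst

/-- Along a sequence tending to `-∞` both the function and its derivative tend to zero. -/
lemma aux_seq {f f' : ℝ → ℝ} (hf : ∀ t, HasDerivAt f (f' t) t)
    (h0 : Tendsto f atBot (𝓝 0)) :
    ∃ ξ : ℕ → ℝ, Tendsto ξ atTop atBot ∧ Tendsto (fun n => f (ξ n)) atTop (𝓝 0) ∧
      Tendsto (fun n => f' (ξ n)) atTop (𝓝 0) := by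
  have h : ∀ n : ℕ, ∃ x ∈ Set.Ioo (-(n : ℝ) - 1) (-(n : ℝ)),
      f' x = (f (-(n : ℝ)) - f (-(n : ℝ) - 1)) / (-(n : ℝ) - (-(n : ℝ) - 1)) := fun n =>
    exists_hasDerivAt_eq_slope f f' (by linarith)
      (fun x _ => (hf x).continuousAt.continuousWithinAt) (fun x _ => hf x)
  choose ξ hξ hd using h
  have hN : Tendsto (fun n : ℕ => -(n : ℝ)) atTop atBot :=
    tendsto_neg_atTop_atBot.comp tendsto_natCast_atTop_atTop
  have hN1 : Tendsto (fun n : ℕ => -(n : ℝ) - 1) atTop atBot :=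
    tendsto_atBot_mono (fun n => by linarith) hN
  have hξt : Tendsto ξ atTop atBot := tendsto_atBot_mono (fun n => (hξ n).2.le) hN
  refine ⟨ξ, hξt, h0.comp hξt, ?_⟩
  have := (h0.comp hN).sub (h0.comp hN1)
  simp only [sub_zero] at this
  refine this.congr (fun n => ?_)
  rw [hd n]
  simp

lemma aux_exp4 (t : ℝ) : Real.exp (4 * t) = Real.exp (2 * t) ^ 2 := by
  rw [← Real.exp_nat_mul]; congr 1; push_cast; ring

lemma aux_n2 {D : ℝ} (hD : 13 ≤ D) :
    (D ^ 2 / 2 + 1) ^ 2 ≤ (D - 1) ^ 2 * (D ^ 2 / 4 + D - 1) := by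
  obtain ⟨x, rfl⟩ : ∃ x, D = 13 + x := ⟨D - 13, by ring⟩
  have hx : 0 ≤ x := by linarith
  rw [← sub_nonneg]
  ring_nf
  positivity

lemma aux_quad {D n y z : ℝ} (hD : 13 ≤ D) (hnp : 0 ≤ n)
    (hn2 : (D ^ 2 / 2 + 1) ^ 2 ≤ (D - 1) ^ 2 * n) :
    (D ^ 2 / 2 + 1) * |y * z| ≤ (D / 2 - 1 / 2) * (y ^ 2 + n * z ^ 2) := by
  have hD' : 0 ≤ D / 2 - 1 / 2 := by linarith
  refine (abs_le_of_sq_le_sq' ?_ (by positivity)).2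
  have ha : 4 * n * (y * z) ^ 2 ≤ (y ^ 2 + n * z ^ 2) ^ 2 := by
    have := sq_nonneg (y ^ 2 - n * z ^ 2)
    linarith
  calc ((D ^ 2 / 2 + 1) * |y * z|) ^ 2 = (D ^ 2 / 2 + 1) ^ 2 * (y * z) ^ 2 := by
        rw [mul_pow, sq_abs]
    _ ≤ ((D - 1) ^ 2 * n) * (y * z) ^ 2 := by gcongr
    _ = (D / 2 - 1 / 2) ^ 2 * (4 * n * (y * z) ^ 2) := by ring
    _ ≤ (D / 2 - 1 / 2) ^ 2 * (y ^ 2 + n * z ^ 2) ^ 2 := by gcongr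
    _ = _ := by ring

/-- Lyapunov estimate for the conjugated equation. -/
lemma aux_lyap {D A τ : ℝ} (hD : 13 ≤ D) (hA : 0 ≤ A) {z z1 z2 S : ℝ → ℝ}
    (hz : ∀ t, HasDerivAt z (z1 t) t) (hz1 : ∀ t, HasDerivAt z1 (z2 t) t)
    (hS : ∀ t ≤ τ, -1 ≤ S t ∧ S t ≤ D ^ 2)
    (hF : ∀ t ≤ τ, |z2 t + D * z1 t + (D - 1 + S t) * z t| ≤ A)
    (h0 : Tendsto z atBot (𝓝 0)) :
    ∀ t ≤ τ, |z t| ≤ A ∧ |z1 t| ≤ 4 * A := by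
  intro t ht
  set n : ℝ := D ^ 2 / 4 + D - 1 with hn
  let V : ℝ → ℝ := fun t => (1 / 2) * (z1 t + D / 2 * z t) ^ 2 + (1 / 2) * n * z t ^ 2
  let W : ℝ → ℝ := fun t => (V t - 2 * A ^ 2) * Real.exp (t / 2)
  let V1 : ℝ → ℝ := fun t =>
    (z1 t + D / 2 * z t) * (z2 t + D / 2 * z1 t) + n * z t * z1 t
  have hV : ∀ t, HasDerivAt V (V1 t) t := by
    intro t
    have h1 := (((hz1 t).add ((hz t).const_mul (D / 2))).pow 2).const_mul (1 / 2 : ℝ)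
    have h2 := ((hz t).pow 2).const_mul ((1 / 2) * n)
    refine (h1.add h2).congr_deriv ?_
    simp only [V1, Pi.add_apply]
    push_cast
    ring
  have hW : ∀ t, HasDerivAt W ((V1 t + (V t - 2 * A ^ 2) / 2) * Real.exp (t / 2)) t := by
    intro t
    have h1 := ((hasDerivAt_id t).div_const 2).exp
    refine (((hV t).sub_const (2 * A ^ 2)).mul h1).congr_deriv ?_
    simp only [id]
    ring
  have key : ∀ t ≤ τ, V1 t + (V t - 2 * A ^ 2) / 2 ≤ 0 := by
    intro t ht
    obtain ⟨s1, s2⟩ := hS t ht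
    have hFt := hF t ht
    set F := z2 t + D * z1 t + (D - 1 + S t) * z t with hFd
    set y := z1 t + D / 2 * z t with hy
    have hF2 : F ^ 2 ≤ A ^ 2 := by
      rw [← sq_abs F]
      exact pow_le_pow_left₀ (abs_nonneg _) hFt 2
    have e1 : z1 t = y - D / 2 * z t := by rw [hy]; ring
    have e2 : z2 t = F - D * z1 t - (D - 1 + S t) * z t := by rw [hFd]; ring
    have hV1 : V1 t = -(D / 2) * y ^ 2 - (S t - D ^ 2 / 2) * (y * z t)
        - D / 2 * n * z t ^ 2 + y * F := by
      simp only [V1]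
      rw [← hy, e2, e1, hn]
      ring
    have hVt : V t = (1 / 2) * y ^ 2 + (1 / 2) * n * z t ^ 2 := rfl
    have hSa : |S t - D ^ 2 / 2| ≤ D ^ 2 / 2 + 1 := by
      rw [abs_le]; constructor <;> linarith
    have hcross : -(S t - D ^ 2 / 2) * (y * z t) ≤ (D ^ 2 / 2 + 1) * |y * z t| := by
      calc _ ≤ |-(S t - D ^ 2 / 2) * (y * z t)| := le_abs_self _
        _ = |S t - D ^ 2 / 2| * |y * z t| := by rw [abs_mul, abs_neg]
        _ ≤ _ := by gcongr
    have hyF : y * F ≤ y ^ 2 / 4 + F ^ 2 := by linarith [sq_nonneg (y / 2 - F)]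
    -- (D²/2+1)|yz| ≤ (D/2 - 1/2)(y² + n z²)
    have hn2 : (D ^ 2 / 2 + 1) ^ 2 ≤ (D - 1) ^ 2 * n := by
      exact aux_n2 hD
    have hnp : 0 ≤ n := by rw [hn]; nlinarith
    have hquad : (D ^ 2 / 2 + 1) * |y * z t| ≤ (D / 2 - 1 / 2) * (y ^ 2 + n * z t ^ 2) :=
      aux_quad hD hnp hn2
    rw [hV1, hVt]
    have : 0 ≤ n * z t ^ 2 := by positivity
    linarith
  obtain ⟨ξ, hξ, hzξ, hz1ξ⟩ := aux_seq hz h0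
  have hWξ : Tendsto (fun k => W (ξ k)) atTop (𝓝 0) := by
    have h1 : Tendsto (fun k => Real.exp (ξ k / 2)) atTop (𝓝 0) :=
      Real.tendsto_exp_atBot.comp (hξ.atBot_div_const (by norm_num))
    have h2 : Tendsto (fun k => V (ξ k)) atTop
        (𝓝 ((1 / 2) * (0 + D / 2 * 0) ^ 2 + (1 / 2) * n * 0 ^ 2)) :=
      (((hz1ξ.add (hzξ.const_mul _)).pow 2).const_mul _).add ((hzξ.pow 2).const_mul _)
    have := (h2.sub_const (2 * A ^ 2)).mul h1
    simpa only [mul_zero] using this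
  have hW0 : W t ≤ 0 := by
    refine ge_of_tendsto hWξ ?_
    filter_upwards [hξ.eventually_le_atBot t] with k hk
    exact aux_anti hW (fun s hs => mul_nonpos_of_nonpos_of_nonneg (key s hs)
      (Real.exp_pos _).le) hk ht
  have hVt : V t ≤ 2 * A ^ 2 := by
    have := nonpos_of_mul_nonpos_left hW0 (Real.exp_pos (t / 2))
    linarith
  simp only [V] at hVt
  have hn42 : D ^ 2 / 4 ≤ n ∧ 4 ≤ n := by rw [hn]; constructor <;> nlinarith
  have hz2 : 0 ≤ z t ^ 2 := sq_nonneg _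
  have hyy : 0 ≤ (z1 t + D / 2 * z t) ^ 2 := sq_nonneg _
  have b1 : |z t| ≤ A := abs_le_of_sq_le_sq (by nlinarith) hA
  have b2 : |z1 t + D / 2 * z t| ≤ 2 * A := abs_le_of_sq_le_sq (by nlinarith) (by linarith)
  have b3 : |D / 2 * z t| ≤ 2 * A := abs_le_of_sq_le_sq (by nlinarith) (by linarith)
  refine ⟨b1, ?_⟩
  rw [abs_le] at *
  constructor <;> linarith

/-- Core linear estimate. -/
lemma aux_core {D A τ : ℝ} (hD : 13 ≤ D) (hA : 0 ≤ A) {u u1 u2 S : ℝ → ℝ}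
    (hu : ∀ t, HasDerivAt u (u1 t) t) (hu1 : ∀ t, HasDerivAt u1 (u2 t) t)
    (hS : ∀ t ≤ τ, -1 ≤ S t ∧ S t ≤ D ^ 2)
    (hF : ∀ t ≤ τ, |u2 t + (D - 4) * u1 t + (3 - D) * u t + S t * u t| ≤ A * Real.exp (2 * t))
    (h0 : Tendsto (fun t => Real.exp (-2 * t) * u t) atBot (𝓝 0)) :
    ∀ t ≤ τ, |u t| ≤ A * Real.exp (2 * t) ∧ |u1 t| ≤ 6 * A * Real.exp (2 * t) := by
  have hE : ∀ t : ℝ, HasDerivAt (fun t => Real.exp (-2 * t)) (-2 * Real.exp (-2 * t)) t := by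
    intro t
    refine ((hasDerivAt_id t).const_mul (-2)).exp.congr_deriv ?_
    simp only [id]; ring
  have hz : ∀ t, HasDerivAt (fun t => Real.exp (-2 * t) * u t)
      (Real.exp (-2 * t) * (u1 t - 2 * u t)) t := fun t =>
    ((hE t).mul (hu t)).congr_deriv (by ring)
  have hz1 : ∀ t, HasDerivAt (fun t => Real.exp (-2 * t) * (u1 t - 2 * u t))
      (Real.exp (-2 * t) * (u2 t - 4 * u1 t + 4 * u t)) t := fun t =>
    ((hE t).mul ((hu1 t).sub ((hu t).const_mul 2))).congr_deriv (by simp only [Pi.sub_apply]; ring)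
  have hee : ∀ t : ℝ, Real.exp (-2 * t) * Real.exp (2 * t) = 1 := by
    intro t; rw [← Real.exp_add]; simp
  have := aux_lyap hD hA hz hz1 hS (fun t ht => by
    have e : Real.exp (-2 * t) * (u2 t - 4 * u1 t + 4 * u t)
        + D * (Real.exp (-2 * t) * (u1 t - 2 * u t))
        + (D - 1 + S t) * (Real.exp (-2 * t) * u t)
        = Real.exp (-2 * t) * (u2 t + (D - 4) * u1 t + (3 - D) * u t + S t * u t) := by ring
    rw [e, abs_mul, abs_of_pos (Real.exp_pos _)]
    calc _ ≤ Real.exp (-2 * t) * (A * Real.exp (2 * t)) := by gcongr; exact hF t ht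
      _ = A * (Real.exp (-2 * t) * Real.exp (2 * t)) := by ring
      _ = A := by rw [hee, mul_one]) h0
  intro t ht
  obtain ⟨h1, h2⟩ := this t ht
  rw [abs_mul, abs_of_pos (Real.exp_pos _)] at h1 h2
  have hp := Real.exp_pos (2 * t)
  have k1 : |u t| ≤ A * Real.exp (2 * t) := by
    calc |u t| = (Real.exp (-2 * t) * Real.exp (2 * t)) * |u t| := by rw [hee, one_mul]
      _ = (Real.exp (-2 * t) * |u t|) * Real.exp (2 * t) := by ring
      _ ≤ _ := by gcongr
  have k2 : |u1 t - 2 * u t| ≤ 4 * A * Real.exp (2 * t) := by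
    calc |u1 t - 2 * u t| = (Real.exp (-2 * t) * Real.exp (2 * t)) * |u1 t - 2 * u t| := by
          rw [hee, one_mul]
      _ = (Real.exp (-2 * t) * |u1 t - 2 * u t|) * Real.exp (2 * t) := by ring
      _ ≤ _ := by gcongr
  refine ⟨k1, ?_⟩
  rw [abs_le] at *
  constructor <;> linarith

/-- Energy bound. -/
lemma aux_energy {D κ τ : ℝ} (hD : 13 ≤ D) (hκ : 0 ≤ κ) (hκτ : κ * Real.exp (2 * τ) ≤ 1)
    {p p1 p2 h : ℝ → ℝ}
    (hp : ∀ t, HasDerivAt p (p1 t) t) (hp1 : ∀ t, HasDerivAt p1 (p2 t) t)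
    (hh : ∀ t ≤ τ, |h t| ≤ κ * Real.exp (2 * t))
    (heq : ∀ t, p2 t + (D - 4) * p1 t + (3 - D) * p t + p t ^ 3 = h t * p t)
    (h0 : Tendsto p atBot (𝓝 0)) :
    ∀ t ≤ τ, 3 * p t ^ 2 ≤ D ^ 2 - 1 ∧ p1 t ^ 2 ≤ D ^ 2 := by
  intro t ht
  let H : ℝ → ℝ := fun t => (1 / 2) * p1 t ^ 2 + (1 / 4) * (p t ^ 2 - (D - 3)) ^ 2 + (D - 2)
  let H1 : ℝ → ℝ := fun t => -(D - 4) * p1 t ^ 2 + h t * p t * p1 t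
  have hH : ∀ t, HasDerivAt H (H1 t) t := by
    intro t
    have a1 := ((hp1 t).pow 2).const_mul (1 / 2 : ℝ)
    have a2 := ((((hp t).pow 2).sub_const (D - 3)).pow 2).const_mul (1 / 4 : ℝ)
    refine ((a1.add a2).add_const (D - 2)).congr_deriv ?_
    have : p2 t = h t * p t - ((D - 4) * p1 t + (3 - D) * p t + p t ^ 3) := by
      linarith [heq t]
    simp only [H1, this, Pi.pow_apply]
    push_cast
    ring
  let E : ℝ → ℝ := fun t => Real.exp (-(κ ^ 2 / 144 * Real.exp (4 * t)))
  have hE : ∀ t, HasDerivAt E (-(κ ^ 2 / 36 * Real.exp (4 * t)) * E t) t := by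
    intro t
    refine ((((hasDerivAt_id t).const_mul 4).exp.const_mul (κ ^ 2 / 144)).neg.exp).congr_deriv ?_
    simp only [id, E, Pi.neg_apply]
    ring
  have hHE : ∀ t, HasDerivAt (fun t => H t * E t)
      ((H1 t - κ ^ 2 / 36 * Real.exp (4 * t) * H t) * E t) t := fun t =>
    ((hH t).mul (hE t)).congr_deriv (by ring)
  have hpH : ∀ t, p t ^ 2 ≤ H t := by
    intro t
    simp only [H]
    nlinarith [sq_nonneg (p1 t), sq_nonneg ((p t ^ 2 - (D - 3)) / 2 - 1)]
  have key : ∀ t ≤ τ, (H1 t - κ ^ 2 / 36 * Real.exp (4 * t) * H t) * E t ≤ 0 := by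
    intro t ht
    refine mul_nonpos_of_nonpos_of_nonneg ?_ (Real.exp_pos _).le
    have hsq : h t ^ 2 ≤ κ ^ 2 * Real.exp (4 * t) := by
      have := pow_le_pow_left₀ (abs_nonneg _) (hh t ht) 2
      rwa [sq_abs, mul_pow, ← aux_exp4] at this
    have h1 : H1 t ≤ h t ^ 2 * p t ^ 2 / 36 := by
      simp only [H1]
      nlinarith [sq_nonneg (h t * p t / 6 - 3 * p1 t), sq_nonneg (p1 t)]
    have h2 : h t ^ 2 * p t ^ 2 ≤ κ ^ 2 * Real.exp (4 * t) * H t := by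
      have := hpH t
      gcongr
    linarith
  obtain ⟨ξ, hξ, hpξ, hp1ξ⟩ := aux_seq hp h0
  have hlim : Tendsto (fun k => H (ξ k)) atTop
      (𝓝 ((1 / 2) * 0 ^ 2 + (1 / 4) * (0 ^ 2 - (D - 3)) ^ 2 + (D - 2))) :=
    (((hp1ξ.pow 2).const_mul _).add ((((hpξ.pow 2).sub_const _).pow 2).const_mul _)).add_const _
  have hHt : H t * E t ≤ (1 / 2) * 0 ^ 2 + (1 / 4) * (0 ^ 2 - (D - 3)) ^ 2 + (D - 2) := by
    refine ge_of_tendsto hlim ?_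
    filter_upwards [hξ.eventually_le_atBot t] with k hk
    have h1 : H t * E t ≤ H (ξ k) * E (ξ k) := aux_anti hHE key hk ht
    have h2 : E (ξ k) ≤ 1 := by
      simp only [E]
      rw [Real.exp_le_one_iff]
      have : 0 ≤ κ ^ 2 / 144 * Real.exp (4 * ξ k) := by positivity
      linarith
    have h3 : 0 ≤ H (ξ k) := (sq_nonneg _).trans (hpH _)
    nlinarith
  have hEt : 143 / 144 ≤ E t := by
    have h1 : κ * Real.exp (2 * t) ≤ 1 := le_trans (by gcongr) hκτ
    have h2 : κ ^ 2 * Real.exp (4 * t) ≤ 1 := by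
      have := pow_le_one₀ (n := 2) (by positivity) h1
      rwa [mul_pow, ← aux_exp4] at this
    have := Real.add_one_le_exp (-(κ ^ 2 / 144 * Real.exp (4 * t)))
    simp only [E]
    linarith
  have h3 : 0 ≤ H t := (sq_nonneg _).trans (hpH _)
  have h4 : H t * (143 / 144) ≤ (1 / 4) * (D - 1) ^ 2 := by nlinarith
  constructor
  · nlinarith [hpH t]
  · have : p1 t ^ 2 ≤ 2 * H t := by
      simp only [H]; nlinarith [sq_nonneg (p t ^ 2 - (D - 3))]
    nlinarith

/-- The estimate in rescaled variables. -/
lemma aux_scaled {D κ τ : ℝ} (hD : 13 ≤ D) (hκ : 0 ≤ κ) (hκτ : κ * Real.exp (2 * τ) ≤ 1)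
    {θ θ1 θ2 θ3 p p1 p2 g g1 g2 h : ℝ → ℝ}
    (hθ : ∀ t, HasDerivAt θ (θ1 t) t) (hθ1 : ∀ t, HasDerivAt θ1 (θ2 t) t)
    (hθ2 : ∀ t, HasDerivAt θ2 (θ3 t) t)
    (hp : ∀ t, HasDerivAt p (p1 t) t) (hp1 : ∀ t, HasDerivAt p1 (p2 t) t)
    (hg : ∀ t, HasDerivAt g (g1 t) t) (hg1 : ∀ t, HasDerivAt g1 (g2 t) t)
    (hh : ∀ t ≤ τ, |h t| ≤ κ * Real.exp (2 * t))
    (eθ : ∀ t, θ2 t + (D - 4) * θ1 t + (3 - D) * θ t + θ t ^ 3 = 0)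
    (eθ' : ∀ t, θ3 t + (D - 4) * θ2 t + (3 - D) * θ1 t + 3 * θ t ^ 2 * θ1 t = 0)
    (ep : ∀ t, p2 t + (D - 4) * p1 t + (3 - D) * p t + p t ^ 3 = h t * p t)
    (eg : ∀ t, g2 t + (D - 4) * g1 t + (3 - D) * g t + 3 * p t ^ 2 * g t = h t * g t)
    (θ0 : Tendsto θ atBot (𝓝 0)) (p0 : Tendsto p atBot (𝓝 0))
    (v0 : Tendsto (fun t => Real.exp (-2 * t) * (p t - θ t)) atBot (𝓝 0))
    (u0 : Tendsto (fun t => Real.exp (-2 * t) * (g t - θ1 t)) atBot (𝓝 0)) :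
    ∀ t ≤ τ, |g t - θ1 t| ≤ κ * (6 * D ^ 3 + D) * Real.exp (2 * t) ∧
      |g1 t - θ2 t| ≤ 6 * (κ * (6 * D ^ 3 + D)) * Real.exp (2 * t) := by
  have bp := aux_energy hD hκ hκτ hp hp1 hh ep p0
  have bθ := aux_energy (τ := τ) (h := fun _ => 0) hD le_rfl (by simp) hθ hθ1 (by simp)
    (fun t => by rw [eθ t]; ring) θ0
  have hD0 : 0 ≤ D := by linarith
  have bp' : ∀ t ≤ τ, |p t| ≤ D := fun t ht =>
    abs_le_of_sq_le_sq (by nlinarith [(bp t ht).1]) hD0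
  have bθ' : ∀ t ≤ τ, |θ t| ≤ D := fun t ht =>
    abs_le_of_sq_le_sq (by nlinarith [(bθ t ht).1]) hD0
  have bθ1 : ∀ t ≤ τ, |θ1 t| ≤ D := fun t ht => abs_le_of_sq_le_sq (bθ t ht).2 hD0
  have hv := aux_core (u := fun t => p t - θ t) (A := κ * D) (τ := τ)
    (S := fun t => p t ^ 2 + p t * θ t + θ t ^ 2) hD (by positivity)
    (fun t => (hp t).sub (hθ t)) (fun t => (hp1 t).sub (hθ1 t))
    (fun t ht => by
      have h1 := (bp t ht).1
      have h2 := (bθ t ht).1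
      constructor
      · nlinarith [sq_nonneg (p t + θ t), sq_nonneg (p t), sq_nonneg (θ t)]
      · nlinarith [sq_nonneg (p t - θ t)])
    (fun t ht => by
      have e : p2 t - θ2 t + (D - 4) * (p1 t - θ1 t) + (3 - D) * (p t - θ t)
          + (p t ^ 2 + p t * θ t + θ t ^ 2) * (p t - θ t) = h t * p t := by
        linear_combination ep t - eθ t
      rw [e, abs_mul]
      calc |h t| * |p t| ≤ (κ * Real.exp (2 * t)) * D := by
            gcongr
            · exact hh t ht
            · exact bp' t ht
        _ = _ := by ring) v0
  refine aux_core (u := fun t => g t - θ1 t) (A := κ * (6 * D ^ 3 + D)) (τ := τ)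
    (S := fun t => 3 * p t ^ 2 - h t) hD (by positivity)
    (fun t => (hg t).sub (hθ1 t)) (fun t => (hg1 t).sub (hθ2 t)) ?_ ?_ u0
  · intro t ht
    have h1 := (bp t ht).1
    have h2 : |h t| ≤ 1 := ((hh t ht).trans (by gcongr)).trans hκτ
    rw [abs_le] at h2
    constructor
    · nlinarith [sq_nonneg (p t)]
    · linarith
  · intro t ht
    have e : g2 t - θ3 t + (D - 4) * (g1 t - θ2 t) + (3 - D) * (g t - θ1 t)
        + (3 * p t ^ 2 - h t) * (g t - θ1 t)
        = -(3 * ((p t - θ t) * (p t + θ t) * θ1 t)) + h t * θ1 t := by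
      linear_combination eg t - eθ' t
    rw [e]
    have hs : |p t + θ t| ≤ 2 * D :=
      (abs_add_le _ _).trans (by linarith [bp' t ht, bθ' t ht])
    calc _ ≤ |-(3 * ((p t - θ t) * (p t + θ t) * θ1 t))| + |h t * θ1 t| := abs_add_le _ _
      _ = 3 * (|p t - θ t| * |p t + θ t| * |θ1 t|) + |h t| * |θ1 t| := by
          rw [abs_neg, abs_mul, abs_mul, abs_mul, abs_mul]; norm_num
      _ ≤ 3 * ((κ * D * Real.exp (2 * t)) * (2 * D) * D) + (κ * Real.exp (2 * t)) * D := by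
          gcongr
          · exact (hv t ht).1
          · exact bθ1 t ht
          · exact hh t ht
          · exact bθ1 t ht
      _ = _ := by ring

lemma aux_asym {f : ℝ → ℝ} {k : ℝ} (hk : 2 < k)
    (hf : f =O[atBot] fun t : ℝ => Real.exp (k * t)) :
    Tendsto (fun t => Real.exp (-2 * t) * f t) atBot (𝓝 0) := by
  have h1 : (fun t => Real.exp (-2 * t) * f t) =O[atBot]
      fun t : ℝ => Real.exp (-2 * t) * Real.exp (k * t) := (isBigO_refl _ _).mul hf
  refine h1.trans_tendsto ?_
  have : Tendsto (fun t : ℝ => (k - 2) * t) atBot atBot :=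
    tendsto_id.const_mul_atBot (by linarith)
  refine (Real.tendsto_exp_atBot.comp this).congr (fun t => ?_)
  simp only [Function.comp]
  rw [← Real.exp_add]; congr 1; ring

lemma aux_C2 {f : ℝ → ℝ} (hf : ContDiff ℝ 2 f) :
    (∀ t, HasDerivAt f (deriv f t) t) ∧ (∀ t, HasDerivAt (deriv f) (deriv (deriv f) t) t) := by
  have h1 : Differentiable ℝ f := hf.differentiable (by norm_num)
  have h2 : ContDiff ℝ 1 (deriv f) := by
    have : ContDiff ℝ (1 + 1) f := by norm_num; exact hf
    exact (contDiff_succ_iff_deriv.1 this).2.2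
  exact ⟨fun t => (h1 t).hasDerivAt, fun t => (h2.differentiable (by norm_num) t).hasDerivAt⟩

/-- Lemma 3.1 (Lemma `lemma:part_b_Psi_b_est` in the paper): after translation by `log b`,
the derivative `γ_b = ∂_b Ψ_b` converges to `b⁻¹ Θ'` on `(-∞,0]` with rate `b⁻³`, and on
`[0, T + a log b]` with rate `b^{-2(1-a)-1}`. Suprema of the two differences are expressed
by quantifying over two independent points `t`, `s`. -/
theorem stmt_2 (d : ℤ) (hd : 13 ≤ d) (lam : ℝ)
    (Θ : ℝ → ℝ) (Ψ γ : ℝ → ℝ → ℝ)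
    (hΘC : ContDiff ℝ 2 Θ)
    (hΘeq : ∀ t : ℝ, deriv (deriv Θ) t + ((d : ℝ) - 4) * deriv Θ t
      + (3 - (d : ℝ)) * Θ t + (Θ t) ^ 3 = 0)
    (hΘasym : (fun t : ℝ => Θ t - Real.exp t + (2 * (d : ℝ))⁻¹ * Real.exp (3 * t))
      =O[atBot] fun t : ℝ => Real.exp (5 * t))
    (hΘ'asym : (fun t : ℝ => deriv Θ t - Real.exp t) =O[atBot] fun t : ℝ => Real.exp (3 * t))
    (hΘ''asym : (fun t : ℝ => deriv (deriv Θ) t - Real.exp t)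
      =O[atBot] fun t : ℝ => Real.exp (3 * t))
    (hΨC : ∀ b : ℝ, 0 < b → ContDiff ℝ 2 (Ψ b))
    (hΨeq : ∀ b : ℝ, 0 < b → ∀ t : ℝ,
      deriv (deriv (Ψ b)) t + ((d : ℝ) - 4) * deriv (Ψ b) t
        + (3 - (d : ℝ)) * Ψ b t + (Ψ b t) ^ 3
        = -lam * Real.exp (2 * t) * Ψ b t + Real.exp (4 * t) * Ψ b t)
    (hΨasym : ∀ b : ℝ, 0 < b →
      (fun t : ℝ => Ψ b t - b * Real.exp t
          + (lam * b + b ^ 3) * (2 * (d : ℝ))⁻¹ * Real.exp (3 * t))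
        =O[atBot] fun t : ℝ => Real.exp (5 * t))
    (hdiff : ∀ b : ℝ, 0 < b → ∀ t : ℝ, HasDerivAt (fun b' => Ψ b' t) (γ b t) b)
    (hγC : ∀ b : ℝ, 0 < b → ContDiff ℝ 2 (γ b))
    (hγeq : ∀ b : ℝ, 0 < b → ∀ t : ℝ,
      deriv (deriv (γ b)) t + ((d : ℝ) - 4) * deriv (γ b) t + (3 - (d : ℝ)) * γ b t
        + 3 * (Ψ b t) ^ 2 * γ b t + lam * Real.exp (2 * t) * γ b t
        - Real.exp (4 * t) * γ b t = 0)
    (hγasym : ∀ b : ℝ, 0 < b →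
      (fun t : ℝ => γ b t - Real.exp t) =O[atBot] fun t : ℝ => Real.exp (3 * t)) :
    (∃ b₀ > (0 : ℝ), ∃ C₀ > (0 : ℝ), ∀ b > b₀, ∀ t ≤ (0 : ℝ), ∀ s ≤ (0 : ℝ),
      |γ b (t - Real.log b) - b⁻¹ * deriv Θ t|
        + |deriv (γ b) (s - Real.log b) - b⁻¹ * deriv (deriv Θ) s|
        ≤ C₀ * b ^ (-3 : ℝ)) ∧
    (∀ T > (0 : ℝ), ∀ a ∈ Set.Ioo (0 : ℝ) 1, ∃ bTa > (0 : ℝ), ∃ CTa > (0 : ℝ),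
      ∀ b > bTa, ∀ t ∈ Set.Icc (0 : ℝ) (T + a * Real.log b),
        ∀ s ∈ Set.Icc (0 : ℝ) (T + a * Real.log b),
          |γ b (t - Real.log b) - b⁻¹ * deriv Θ t|
            + |deriv (γ b) (s - Real.log b) - b⁻¹ * deriv (deriv Θ) s|
            ≤ CTa * b ^ (-2 * (1 - a) - 1)) := by
  set D : ℝ := (d : ℝ) with hDd
  have hD : (13 : ℝ) ≤ D := by rw [hDd]; exact_mod_cast hd
  set K : ℝ := (|lam| + 1) * (6 * D ^ 3 + D) with hK
  have hKpos : 0 < K := by positivity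
  have hexp0 : Tendsto Real.exp atBot (𝓝 0) := Real.tendsto_exp_atBot
  have e3 : Tendsto (fun t : ℝ => Real.exp (-2 * t) * Real.exp (3 * t)) atBot (𝓝 0) :=
    aux_asym (k := 3) (by norm_num) (isBigO_refl _ _)
  have hee : ∀ t : ℝ, Real.exp (2 * t) * Real.exp (-2 * t) = 1 := by
    intro t; rw [← Real.exp_add]; simp
  have hexp2 : Tendsto (fun t : ℝ => Real.exp (2 * t)) atBot (𝓝 0) :=
    hexp0.comp (tendsto_id.const_mul_atBot (by norm_num))
  -- from weighted smallness to smallness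
  have small : ∀ f : ℝ → ℝ, Tendsto (fun t => Real.exp (-2 * t) * (f t - Real.exp t)) atBot (𝓝 0) →
      Tendsto f atBot (𝓝 0) := by
    intro f hf
    have := (hexp2.mul hf).add hexp0
    simp only [mul_zero, add_zero] at this
    refine this.congr (fun t => ?_)
    rw [← mul_assoc, hee]; ring
  have wΘ : Tendsto (fun t => Real.exp (-2 * t) * (Θ t - Real.exp t)) atBot (𝓝 0) := by
    have := (aux_asym (k := 5) (by norm_num) hΘasym).sub (e3.const_mul (2 * D)⁻¹)
    simp only [mul_zero, sub_zero] at this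
    exact this.congr (fun t => by ring)
  have wΘ1 := aux_asym (k := 3) (by norm_num) hΘ'asym
  obtain ⟨dΘ, dΘ1⟩ := aux_C2 hΘC
  have dΘ2 : ∀ t, HasDerivAt (deriv (deriv Θ))
      (-((D - 4) * deriv (deriv Θ) t + (3 - D) * deriv Θ t + 3 * Θ t ^ 2 * deriv Θ t)) t := by
    intro t
    have e : deriv (deriv Θ) = fun t => -((D - 4) * deriv Θ t + (3 - D) * Θ t + Θ t ^ 3) := by
      funext s; linarith [hΘeq s]
    have h1 := ((((dΘ1 t).const_mul (D - 4)).add ((dΘ t).const_mul (3 - D))).add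
      ((dΘ t).pow 3)).neg
    have h2 : HasDerivAt (fun t => -((D - 4) * deriv Θ t + (3 - D) * Θ t + Θ t ^ 3))
      (-((D - 4) * deriv (deriv Θ) t + (3 - D) * deriv Θ t + 3 * Θ t ^ 2 * deriv Θ t)) t := by
      refine h1.congr_deriv ?_
      push_cast
      ring
    rw [← e] at h2
    exact h2
  have main : ∀ b τ : ℝ, 0 < b → (|lam| + 1) * (b⁻¹ ^ 2 * Real.exp (2 * τ)) ≤ 1 → ∀ t ≤ τ,
      |γ b (t - Real.log b) - b⁻¹ * deriv Θ t| ≤ K * (b⁻¹ ^ 3 * Real.exp (2 * t)) ∧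
      |deriv (γ b) (t - Real.log b) - b⁻¹ * deriv (deriv Θ) t|
        ≤ 6 * K * (b⁻¹ ^ 3 * Real.exp (2 * t)) := by
    intro b τ hb hτ t ht
    set L := Real.log b with hL
    have expL : ∀ t, Real.exp (t - L) = b⁻¹ * Real.exp t := by
      intro t; rw [Real.exp_sub, hL, Real.exp_log hb]; field_simp
    have expn : ∀ (n : ℕ) t, Real.exp (n * (t - L)) = b⁻¹ ^ n * Real.exp (n * t) := by
      intro n t; rw [Real.exp_nat_mul, expL, mul_pow, Real.exp_nat_mul]
    have exp2 : ∀ t, Real.exp (2 * (t - L)) = b⁻¹ ^ 2 * Real.exp (2 * t) := by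
      intro t; simpa using expn 2 t
    have exp4 : ∀ t, Real.exp (4 * (t - L)) = b⁻¹ ^ 4 * Real.exp (4 * t) := by
      intro t; simpa using expn 4 t
    have expm2 : ∀ t, Real.exp (-2 * (t - L)) = b ^ 2 * Real.exp (-2 * t) := by
      intro t
      rw [show -2 * (t - L) = -(2 * (t - L)) by ring, Real.exp_neg, exp2,
        show -2 * t = -(2 * t) by ring, Real.exp_neg]
      field_simp
    have shift : Tendsto (fun t : ℝ => t - L) atBot atBot :=
      tendsto_atBot_add_const_right _ (-L) tendsto_id
    obtain ⟨dΨ, dΨ1⟩ := aux_C2 (hΨC b hb)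
    obtain ⟨dγ, dγ1⟩ := aux_C2 (hγC b hb)
    have wΨ : Tendsto (fun t => Real.exp (-2 * t) * (Ψ b (t - L) - Real.exp t)) atBot (𝓝 0) := by
      have h1 := (aux_asym (k := 5) (by norm_num) (hΨasym b hb)).sub
        (e3.const_mul ((lam * b + b ^ 3) * (2 * D)⁻¹))
      simp only [mul_zero, sub_zero] at h1
      have h2 := (h1.comp shift).const_mul (b⁻¹ ^ 2)
      simp only [mul_zero] at h2
      refine h2.congr (fun t => ?_)
      simp only [Function.comp]
      rw [expm2, expL]
      field_simp
      ring
    have wγ : Tendsto (fun t => Real.exp (-2 * t) * (b * γ b (t - L) - Real.exp t))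
        atBot (𝓝 0) := by
      have h2 := ((aux_asym (k := 3) (by norm_num) (hγasym b hb)).comp shift).const_mul (b⁻¹)
      simp only [mul_zero] at h2
      refine h2.congr (fun t => ?_)
      simp only [Function.comp]
      rw [expm2, expL]
      field_simp
    have hτ1 : b⁻¹ ^ 2 * Real.exp (2 * τ) ≤ 1 := by
      have : 0 ≤ b⁻¹ ^ 2 * Real.exp (2 * τ) := by positivity
      nlinarith [abs_nonneg lam]
    have := aux_scaled (D := D) (κ := (|lam| + 1) * b⁻¹ ^ 2) (τ := τ) hD (by positivity)
      (by rw [mul_assoc]; exact hτ)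
      (θ := Θ) (p := fun t => Ψ b (t - L)) (g := fun t => b * γ b (t - L))
      (h := fun t => -lam * Real.exp (2 * (t - L)) + Real.exp (4 * (t - L)))
      dΘ dΘ1 dΘ2
      (fun t => (dΨ (t - L)).comp_sub_const t L) (fun t => (dΨ1 (t - L)).comp_sub_const t L)
      (fun t => ((dγ (t - L)).comp_sub_const t L).const_mul b)
      (fun t => ((dγ1 (t - L)).comp_sub_const t L).const_mul b)
      (by
        intro t ht
        rw [exp2, exp4]
        have hx : b⁻¹ ^ 2 * Real.exp (2 * t) ≤ 1 := le_trans (by gcongr) hτ1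
        have h4 : b⁻¹ ^ 4 * Real.exp (4 * t) = (b⁻¹ ^ 2 * Real.exp (2 * t)) ^ 2 := by
          rw [mul_pow, ← aux_exp4, ← pow_mul]
        rw [h4]
        have hx0 : 0 ≤ b⁻¹ ^ 2 * Real.exp (2 * t) := by positivity
        rw [mul_assoc (|lam| + 1)]
        generalize b⁻¹ ^ 2 * Real.exp (2 * t) = x at hx hx0
        calc |-lam * x + x ^ 2| ≤ |-lam * x| + |x ^ 2| := abs_add_le _ _
          _ = |lam| * x + x ^ 2 := by
              rw [abs_mul, abs_neg, abs_of_nonneg hx0, abs_of_nonneg (sq_nonneg x)]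
          _ ≤ _ := by nlinarith)
      hΘeq (fun t => by ring)
      (fun t => by linear_combination hΨeq b hb (t - L))
      (fun t => by linear_combination b * hγeq b hb (t - L))
      (small _ wΘ) (small _ wΨ)
      (by
        have := wΨ.sub wΘ
        simp only [sub_zero] at this
        exact this.congr (fun t => by ring))
      (by
        have := wγ.sub wΘ1
        simp only [sub_zero] at this
        exact this.congr (fun t => by ring)) t ht
    obtain ⟨h1, h2⟩ := this
    have hbi : 0 < b⁻¹ := inv_pos.2 hb
    have hbb : b⁻¹ * b = 1 := inv_mul_cancel₀ hb.ne'
    constructor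
    · calc _ = |b⁻¹ * (b * γ b (t - L) - deriv Θ t)| := by
            congr 1; rw [mul_sub, ← mul_assoc, hbb, one_mul]
        _ = b⁻¹ * |b * γ b (t - L) - deriv Θ t| := by rw [abs_mul, abs_of_pos hbi]
        _ ≤ _ := mul_le_mul_of_nonneg_left h1 hbi.le
        _ = _ := by rw [hK]; ring
    · calc _ = |b⁻¹ * (b * deriv (γ b) (t - L) - deriv (deriv Θ) t)| := by
            congr 1; rw [mul_sub, ← mul_assoc, hbb, one_mul]
        _ = b⁻¹ * |b * deriv (γ b) (t - L) - deriv (deriv Θ) t| := by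
            rw [abs_mul, abs_of_pos hbi]
        _ ≤ _ := mul_le_mul_of_nonneg_left h2 hbi.le
        _ = _ := by rw [hK]; ring
  have rp : ∀ b : ℝ, 0 < b → b⁻¹ ^ 3 = b ^ (-3 : ℝ) := by
    intro b hb
    rw [Real.rpow_neg hb.le, inv_pow]
    congr 1
    exact_mod_cast (Real.rpow_natCast b 3).symm
  constructor
  · refine ⟨|lam| + 1, by positivity, 7 * K, by positivity, fun b hb t ht s hs => ?_⟩
    have hb1 : 1 ≤ b := by linarith [abs_nonneg lam]
    have hb0 : 0 < b := by linarith
    have hc : (|lam| + 1) * (b⁻¹ ^ 2 * Real.exp (2 * 0)) ≤ 1 := by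
      rw [mul_zero, Real.exp_zero, mul_one, inv_pow, ← div_eq_mul_inv,
        div_le_one (by positivity)]
      nlinarith
    have h1 := (main b 0 hb0 hc t ht).1
    have h2 := (main b 0 hb0 hc s hs).2
    have et : Real.exp (2 * t) ≤ 1 := Real.exp_le_one_iff.2 (by linarith)
    have es : Real.exp (2 * s) ≤ 1 := Real.exp_le_one_iff.2 (by linarith)
    rw [← rp b hb0]
    have hq : 0 ≤ b⁻¹ ^ 3 := by positivity
    have h3 : K * (b⁻¹ ^ 3 * Real.exp (2 * t)) ≤ K * (b⁻¹ ^ 3 * 1) := by gcongr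
    have h4 : 6 * K * (b⁻¹ ^ 3 * Real.exp (2 * s)) ≤ 6 * K * (b⁻¹ ^ 3 * 1) := by gcongr
    linarith
  · intro T hT a ha
    obtain ⟨ha0, ha1⟩ := ha
    have hlim : Tendsto (fun b : ℝ => (|lam| + 1) * Real.exp (2 * T) * b ^ (-(2 * (1 - a))))
        atTop (𝓝 0) := by
      have := (tendsto_rpow_neg_atTop (y := 2 * (1 - a)) (by linarith)).const_mul
        ((|lam| + 1) * Real.exp (2 * T))
      simpa using this
    obtain ⟨B, hB⟩ := (hlim.eventually_le_const (by norm_num : (0 : ℝ) < 1)).exists_forall_of_atTop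
    refine ⟨max B 1, by positivity, 7 * K * Real.exp (2 * T), by positivity, ?_⟩
    intro b hb t ht s hs
    have hb0 : 0 < b := by linarith [le_max_right B 1]
    have hBb : B ≤ b := by linarith [le_max_left B 1]
    have eτ : Real.exp (2 * (T + a * Real.log b)) = Real.exp (2 * T) * b ^ (2 * a) := by
      rw [Real.rpow_def_of_pos hb0, ← Real.exp_add]; congr 1; ring
    have r2 : b⁻¹ ^ 2 * b ^ (2 * a) = b ^ (-(2 * (1 - a))) := by
      have : b⁻¹ ^ 2 = b ^ (-2 : ℝ) := by
        rw [Real.rpow_neg hb0.le, inv_pow]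
        congr 1
        exact_mod_cast (Real.rpow_natCast b 2).symm
      rw [this, ← Real.rpow_add hb0]; congr 1; ring
    have r3 : b⁻¹ ^ 3 * b ^ (2 * a) = b ^ (-2 * (1 - a) - 1) := by
      rw [rp b hb0, ← Real.rpow_add hb0]; congr 1; ring
    have hc : (|lam| + 1) * (b⁻¹ ^ 2 * Real.exp (2 * (T + a * Real.log b))) ≤ 1 := by
      have := hB b hBb
      rw [← r2] at this
      rw [eτ]
      linarith
    have h1 := (main b _ hb0 hc t ht.2).1
    have h2 := (main b _ hb0 hc s hs.2).2
    have et : Real.exp (2 * t) ≤ Real.exp (2 * T) * b ^ (2 * a) := by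
      rw [← eτ]; exact Real.exp_le_exp.2 (by linarith [ht.2])
    have es : Real.exp (2 * s) ≤ Real.exp (2 * T) * b ^ (2 * a) := by
      rw [← eτ]; exact Real.exp_le_exp.2 (by linarith [hs.2])
    have h3 : K * (b⁻¹ ^ 3 * Real.exp (2 * t))
        ≤ K * (b⁻¹ ^ 3 * (Real.exp (2 * T) * b ^ (2 * a))) := by gcongr
    have h4 : 6 * K * (b⁻¹ ^ 3 * Real.exp (2 * s))
        ≤ 6 * K * (b⁻¹ ^ 3 * (Real.exp (2 * T) * b ^ (2 * a))) := by gcongr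
    rw [← r3]
    linarith
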